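/- Let (Ω, μ) be a probability space and let S : Ω → 𝒮 and R : Ω → ℛ be measurable random variables taking values in finite types (with the discrete measurable structure) such that S and R are independent. Let φ : 𝒮 × ℛ → ℰ be a function into a finite type and set E = φ(S, R). If the conditional entropy satisfies H[R | ⟨S, E⟩] = 0, then H[E | S] = H[R], and consequently the mutual information satisfies I[S : E] = H[E] − H[R]. -/

import Mathlib

open MeasureTheory ProbabilityTheory

/-- Shannon entropy `H[X]` of a random variable `X : Ω → S` taking values in a finite type,
with respect to the measure `μ`. -/
noncomputable def shannonEntropy {Ω : Type*} [MeasurableSpace Ω] (μ : Measure Ω)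
    {S : Type*} [Fintype S] (X : Ω → S) : ℝ :=
  ∑ s : S, Real.negMulLog ((μ (X ⁻¹' {s})).toReal)

/-- Conditional Shannon entropy `H[X | Y] = H[⟨X, Y⟩] − H[Y]`. -/
noncomputable def shannonCondEntropy {Ω : Type*} [MeasurableSpace Ω] (μ : Measure Ω)
    {S T : Type*} [Fintype S] [Fintype T] (X : Ω → S) (Y : Ω → T) : ℝ :=
  shannonEntropy μ (fun ω => (X ω, Y ω)) - shannonEntropy μ Y

/-- Mutual information `I[X : Y] = H[X] + H[Y] − H[⟨X, Y⟩]`. -/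
noncomputable def shannonMutualInfo {Ω : Type*} [MeasurableSpace Ω] (μ : Measure Ω)
    {S T : Type*} [Fintype S] [Fintype T] (X : Ω → S) (Y : Ω → T) : ℝ :=
  shannonEntropy μ X + shannonEntropy μ Y - shannonEntropy μ (fun ω => (X ω, Y ω))

section Entropy

variable {Ω S T : Type*} [MeasurableSpace Ω] [Fintype S] [Fintype T]

lemma shannonEntropy_comp_of_injective (μ : Measure Ω) (X : Ω → S) {f : S → T}
    (hf : Function.Injective f) :
    shannonEntropy μ (fun ω => f (X ω)) = shannonEntropy μ X := by
  refine (Fintype.sum_of_injective f hf _ _ (fun t ht => ?_) fun s => ?_).symm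
  · have : (fun ω => f (X ω)) ⁻¹' {t} = ∅ :=
      Set.eq_empty_of_forall_notMem fun ω hω => ht ⟨X ω, hω⟩
    simp [this]
  · have : (fun ω => f (X ω)) ⁻¹' {f s} = X ⁻¹' {s} := by
      ext ω
      exact hf.eq_iff
    rw [this]

lemma sum_toReal_measure_preimage_singleton [MeasurableSpace S] [MeasurableSingletonClass S]
    (μ : Measure Ω) [IsProbabilityMeasure μ] {X : Ω → S} (hX : Measurable X) :
    ∑ s, (μ (X ⁻¹' {s})).toReal = 1 := by
  rw [← ENNReal.toReal_sum fun s _ => measure_ne_top μ _,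
    sum_measure_preimage_singleton _ fun s _ => hX (measurableSet_singleton s)]
  simp

lemma shannonEntropy_prodMk_of_indepFun [MeasurableSpace S] [MeasurableSingletonClass S]
    [MeasurableSpace T] [MeasurableSingletonClass T]
    (μ : Measure Ω) [IsProbabilityMeasure μ] {X : Ω → S} {Y : Ω → T}
    (hX : Measurable X) (hY : Measurable Y) (h : IndepFun X Y μ) :
    shannonEntropy μ (fun ω => (X ω, Y ω)) = shannonEntropy μ X + shannonEntropy μ Y := by
  have key (s : S) (t : T) : (μ ((fun ω => (X ω, Y ω)) ⁻¹' {(s, t)})).toReal =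
      (μ (X ⁻¹' {s})).toReal * (μ (Y ⁻¹' {t})).toReal := by
    rw [← ENNReal.toReal_mul, ← h.measure_inter_preimage_eq_mul _ _
      (measurableSet_singleton s) (measurableSet_singleton t), ← Set.singleton_prod_singleton,
      Set.mk_preimage_prod]
  simp only [shannonEntropy, Fintype.sum_prod_type, key, Real.negMulLog_mul,
    Finset.sum_add_distrib, ← Finset.sum_mul, ← Finset.mul_sum,
    sum_toReal_measure_preimage_singleton μ hX, sum_toReal_measure_preimage_singleton μ hY,
    one_mul]

end Entropy

/-- Let `S` and `R` be independent finite-valued random variables on a probability space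
`(Ω, μ)`, and let `E = φ (S, R)` for a function `φ` into a finite type.
If `H[R | ⟨S, E⟩] = 0`, then `H[E | S] = H[R]`, and consequently
`I[S : E] = H[E] − H[R]`. -/
theorem stmt_6 {Ω 𝒮 ℛ ℰ : Type*} [MeasurableSpace Ω]
    [MeasurableSpace 𝒮] [DiscreteMeasurableSpace 𝒮] [Fintype 𝒮]
    [MeasurableSpace ℛ] [DiscreteMeasurableSpace ℛ] [Fintype ℛ]
    [MeasurableSpace ℰ] [DiscreteMeasurableSpace ℰ] [Fintype ℰ]
    (μ : Measure Ω) [IsProbabilityMeasure μ]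
    (S : Ω → 𝒮) (R : Ω → ℛ) (hS : Measurable S) (hR : Measurable R)
    (hSR : IndepFun S R μ) (φ : 𝒮 × ℛ → ℰ)
    (hcond : shannonCondEntropy μ R (fun ω => (S ω, φ (S ω, R ω))) = 0) :
    shannonCondEntropy μ (fun ω => φ (S ω, R ω)) S = shannonEntropy μ R ∧
      shannonMutualInfo μ S (fun ω => φ (S ω, R ω)) =
        shannonEntropy μ (fun ω => φ (S ω, R ω)) - shannonEntropy μ R := by
  have hinj : Function.Injective fun p : 𝒮 × ℛ => (p.2, (p.1, φ p)) := by
    rintro ⟨s, r⟩ ⟨s', r'⟩ h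
    simp_all
  have hRSE := shannonEntropy_comp_of_injective μ (fun ω => (S ω, R ω)) hinj
  have hES := shannonEntropy_comp_of_injective μ (fun ω => (S ω, φ (S ω, R ω)))
    Prod.swap_injective
  have hprod := shannonEntropy_prodMk_of_indepFun μ hS hR hSR
  simp only [Prod.swap_prod_mk] at hES
  simp only [shannonCondEntropy, shannonMutualInfo] at hcond ⊢
  constructor <;> linarith
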